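/- arXiv:1912.13296 — 2 statements merged into one kernel-verified Lean document; each statement's English description precedes it below -/
import Mathlib

section
/- For every m ∈ ℕ there exists N_m ∈ ℕ depending only on m (in particular not on the dimension d) such that for every d ∈ ℕ, all random vectors ξ, ξ' in ℝ^d, and every λ > 0, π_{λ,m}(ξ, ξ') ≤ L_{λ/2, N_m}(ξ, ξ'). -/
open MeasureTheory
open scoped RealInnerProductSpace

noncomputable section

/-- `ℝ^d` with the Euclidean norm. -/
abbrev Euc (d : ℕ) := EuclideanSpace ℝ (Fin d)

/-- The convex polyhedron `{x : ⟨x, t j⟩ ≤ b j, j = 1,…,m}`. -/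
def polySet {d m : ℕ} (t : Fin m → Euc d) (b : Fin m → ℝ) : Set (Euc d) :=
  {x | ∀ j, ⟪x, t j⟫ ≤ b j}

/-- The probability that a measure assigns to a set, as a real number. -/
def pr {d : ℕ} (P : Measure (Euc d)) (s : Set (Euc d)) : ℝ := (P s).toReal

/-- `L_{λ,m}`: sup over polyhedra in `𝒫_m` (with representation) of
`max (P(P) - Q(P_λ), Q(P) - P(P_λ))`. -/
def LlamPoly {d : ℕ} (m : ℕ) (P Q : Measure (Euc d)) (lam : ℝ) : ℝ :=
  sSup {r | ∃ (t : Fin m → Euc d) (b : Fin m → ℝ), (∀ j, ‖t j‖ = 1) ∧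
    r = max (pr P (polySet t b) - pr Q (polySet t (fun j => b j + lam)))
            (pr Q (polySet t b) - pr P (polySet t (fun j => b j + lam)))}

/-- `π_{λ,m}`: sup over polyhedra in `𝒫_m` of `max (P(P) - Q(P^λ), Q(P) - P(P^λ))`,
where `P^λ` is the open `λ`-neighborhood of `P`. -/
def pilamPoly {d : ℕ} (m : ℕ) (P Q : Measure (Euc d)) (lam : ℝ) : ℝ :=
  sSup {r | ∃ (t : Fin m → Euc d) (b : Fin m → ℝ), (∀ j, ‖t j‖ = 1) ∧
    r = max (pr P (polySet t b) - pr Q (Metric.thickening lam (polySet t b)))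
            (pr Q (polySet t b) - pr P (Metric.thickening lam (polySet t b)))}

/-- In a real normed space of dimension at most `m`, every subset `A` of the unit sphere contains
a finite `1`-net of `A` with at most `5 ^ m` elements. -/
lemma exists_finset_net_of_finrank_le {E : Type*} [NormedAddCommGroup E] [NormedSpace ℝ E]
    [FiniteDimensional ℝ E] {m : ℕ} (hm : Module.finrank ℝ E ≤ m) (A : Set E)
    (hA : ∀ u ∈ A, ‖u‖ = 1) :
    ∃ S : Finset E, ↑S ⊆ A ∧ S.card ≤ 5 ^ m ∧ ∀ u ∈ A, ∃ s ∈ S, ‖u - s‖ < 1 := by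
  classical
  have hcard : ∀ S : Finset E, ↑S ⊆ A → (∀ c ∈ S, ∀ d ∈ S, c ≠ d → 1 ≤ ‖c - d‖) →
      S.card ≤ 5 ^ m := fun S hS hsep =>
    (Besicovitch.card_le_of_separated S (fun c hc => by rw [hA c (hS hc)]; norm_num) hsep).trans
      (Nat.pow_le_pow_right (by norm_num) hm)
  by_contra! h
  have key : ∀ n : ℕ, ∃ S : Finset E, ↑S ⊆ A ∧
      (∀ c ∈ S, ∀ d ∈ S, c ≠ d → 1 ≤ ‖c - d‖) ∧ S.card = n := by
    intro n
    induction n with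
    | zero => exact ⟨∅, by simp, by simp, by simp⟩
    | succ n ih =>
      obtain ⟨S, hS, hsep, hn⟩ := ih
      obtain ⟨u, hu, hfar⟩ := h S hS (hcard S hS hsep)
      have hnot : u ∉ S := fun hmem => by
        have := hfar u hmem
        simp at this
        linarith
      refine ⟨insert u S, ?_, ?_, by rw [Finset.card_insert_of_notMem hnot, hn]⟩
      · rw [Finset.coe_insert]
        exact Set.insert_subset hu hS
      · intro c hc d hd hcd
        rcases Finset.mem_insert.1 hc with rfl | hcS <;>
          rcases Finset.mem_insert.1 hd with rfl | hdS
        · exact absurd rfl hcd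
        · exact hfar d hdS
        · rw [norm_sub_rev]
          exact hfar c hcS
        · exact hsep c hcS d hdS hcd
  obtain ⟨S, hS, hsep, hn⟩ := key (5 ^ m + 1)
  have := hcard S hS hsep
  omega

/-- A subset of the unit sphere contained in a subspace of dimension at most `m` contains a finite
`1`-net of itself with at most `5 ^ m` elements. -/
lemma exists_finset_net_of_subset_submodule {E : Type*} [NormedAddCommGroup E] [NormedSpace ℝ E]
    (V : Submodule ℝ E) [FiniteDimensional ℝ V] {m : ℕ} (hm : Module.finrank ℝ V ≤ m) (A : Set E)
    (hAV : A ⊆ V) (hA : ∀ u ∈ A, ‖u‖ = 1) :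
    ∃ S : Finset E, ↑S ⊆ A ∧ S.card ≤ 5 ^ m ∧ ∀ u ∈ A, ∃ s ∈ S, ‖u - s‖ < 1 := by
  obtain ⟨S, hS, hcard, hnet⟩ := exists_finset_net_of_finrank_le hm
    (Subtype.val ⁻¹' A : Set V)
    (fun u hu => hA u hu)
  refine ⟨S.map ⟨(↑), Subtype.val_injective⟩, ?_, by simpa using hcard, ?_⟩
  · intro x hx
    simp only [Finset.coe_map, Function.Embedding.coeFn_mk, Set.mem_image] at hx
    obtain ⟨v, hv, rfl⟩ := hx
    exact hS hv
  · intro u hu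
    obtain ⟨s, hs, hlt⟩ := hnet ⟨u, hAV hu⟩ hu
    exact ⟨s, Finset.mem_map_of_mem _ hs, hlt⟩

lemma convex_polySet {d m : ℕ} (t : Fin m → Euc d) (b : Fin m → ℝ) : Convex ℝ (polySet t b) := by
  intro x hx y hy p q hp hq hpq j
  rw [inner_add_left, real_inner_smul_left, real_inner_smul_left]
  calc p * ⟪x, t j⟫ + q * ⟪y, t j⟫ ≤ p * b j + q * b j :=
        add_le_add (mul_le_mul_of_nonneg_left (hx j) hp) (mul_le_mul_of_nonneg_left (hy j) hq)
    _ = b j := by rw [← add_mul, hpq, one_mul]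

lemma isClosed_polySet {d m : ℕ} (t : Fin m → Euc d) (b : Fin m → ℝ) :
    IsClosed (polySet t b) := by
  simp only [polySet, Set.ofPred_forall]
  exact isClosed_iInter fun j => isClosed_le (by fun_prop) continuous_const

/-- A linear functional maximised over a polyhedron lies in the span of the facet normals. -/
lemma mem_span_of_inner_le {d m : ℕ} {t : Fin m → Euc d} {b : Fin m → ℝ} {u y : Euc d}
    (hy : y ∈ polySet t b) (hu : ∀ z ∈ polySet t b, ⟪z, u⟫ ≤ ⟪y, u⟫) :
    u ∈ Submodule.span ℝ (Set.range t) := by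
  rw [← Submodule.orthogonal_orthogonal (Submodule.span ℝ (Set.range t)),
    Submodule.mem_orthogonal]
  intro w hw
  have hwt : ∀ j, ⟪w, t j⟫ = 0 := fun j =>
    Submodule.inner_left_of_mem_orthogonal (Submodule.subset_span (Set.mem_range_self j)) hw
  have hplus := hu (y + w) fun j => by
    rw [inner_add_left, hwt j, add_zero]
    exact hy j
  have hminus := hu (y - w) fun j => by
    rw [inner_sub_left, hwt j, sub_zero]
    exact hy j
  rw [inner_add_left] at hplus
  rw [inner_sub_left] at hminus
  linarith

/-- The normal cone of a polyhedron at a point depends only on the set of active constraints. -/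
lemma inner_le_of_active_iff {d m : ℕ} {t : Fin m → Euc d} {b : Fin m → ℝ} {u y y' : Euc d}
    (hy : y ∈ polySet t b) (hu : ∀ z ∈ polySet t b, ⟪z, u⟫ ≤ ⟪y, u⟫)
    (hact : ∀ j, ⟪y, t j⟫ = b j → ⟪y', t j⟫ = b j) :
    ∀ z ∈ polySet t b, ⟪z, u⟫ ≤ ⟪y', u⟫ := by
  intro z hz
  have hev : ∀ᶠ ε : ℝ in nhdsWithin 0 (Set.Ioi 0), y + ε • (z - y') ∈ polySet t b := by
    simp only [polySet, Set.mem_ofPred_eq]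
    rw [Filter.eventually_all]
    intro j
    rcases (hy j).eq_or_lt with heq | hlt
    · filter_upwards [self_mem_nhdsWithin] with ε hε
      have hzj := hz j
      rw [inner_add_left, real_inner_smul_left, inner_sub_left, heq, hact j heq]
      have := mul_nonneg (le_of_lt (Set.mem_Ioi.1 hε)) (sub_nonneg.2 hzj)
      linarith
    · have hcont : Continuous fun ε : ℝ => ⟪y + ε • (z - y'), t j⟫ := by fun_prop
      have h0 : ⟪y + (0 : ℝ) • (z - y'), t j⟫ < b j := by simpa using hlt
      filter_upwards [(hcont.continuousAt.eventually_lt continuousAt_const h0).filter_mono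
        nhdsWithin_le_nhds] with ε hε using hε.le
  obtain ⟨ε, hmem, hε⟩ := (hev.and self_mem_nhdsWithin).exists
  have h := hu _ hmem
  rw [inner_add_left, real_inner_smul_left, inner_sub_left] at h
  have : ε * (⟪z, u⟫ - ⟪y', u⟫) ≤ 0 := by linarith
  have := nonpos_of_mul_nonpos_right this hε
  linarith

/-- A nonempty finset with at most `N` elements is the range of a map from `Fin N`. -/
lemma Finset.exists_fin_range_eq {α : Type*} {S : Finset α} (hS : S.Nonempty) {N : ℕ}
    (hN : S.card ≤ N) : ∃ f : Fin N → α, Set.range f = S := by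
  have : Nonempty S := hS.to_subtype
  obtain ⟨g⟩ := Function.Embedding.nonempty_of_card_le (α := S) (β := Fin N) (by simpa using hN)
  refine ⟨Subtype.val ∘ Function.invFun g, ?_⟩
  rw [(Function.invFun_surjective g.injective).range_comp]
  simp

/-- A nonempty polyhedron with `m` facets is contained in a polyhedron with `10 ^ m + 1` facets
whose relaxation by `lam / 2` stays inside the `lam`-neighbourhood of the original. -/
lemma exists_polySet_relax_subset_thickening {d m : ℕ} {t : Fin m → Euc d} {b : Fin m → ℝ}
    (ht : ∀ j, ‖t j‖ = 1) (hm : 0 < m) (hne : (polySet t b).Nonempty) {lam : ℝ}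
    (hlam : 0 < lam) :
    ∃ (s : Fin (10 ^ m + 1) → Euc d) (c : Fin (10 ^ m + 1) → ℝ), (∀ j, ‖s j‖ = 1) ∧
      polySet t b ⊆ polySet s c ∧
      polySet s (fun j => c j + lam / 2) ⊆ Metric.thickening lam (polySet t b) := by
  classical
  let V := Submodule.span ℝ (Set.range t)
  have hV : Module.finrank ℝ V ≤ m :=
    (finrank_range_le_card t).trans_eq (Fintype.card_fin m)
  let A : Set (Fin m) → Set (Euc d) := fun J => {u | ‖u‖ = 1 ∧ ∃ y ∈ polySet t b,
    {j | ⟪y, t j⟫ = b j} = J ∧ ∀ z ∈ polySet t b, ⟪z, u⟫ ≤ ⟪y, u⟫}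
  have hnet : ∀ J, ∃ S : Finset (Euc d), ↑S ⊆ A J ∧ S.card ≤ 5 ^ m ∧
      ∀ u ∈ A J, ∃ s ∈ S, ‖u - s‖ < 1 := fun J =>
    exists_finset_net_of_subset_submodule V hV (A J)
      (fun u hu => by
        obtain ⟨-, y, hy, -, hmax⟩ := hu
        exact mem_span_of_inner_le hy hmax)
      (fun u hu => hu.1)
  choose S hSA hScard hSnet using hnet
  let T : Finset (Euc d) := insert (t ⟨0, hm⟩) (Finset.univ.biUnion S)
  have hTcard : T.card ≤ 10 ^ m + 1 := by
    refine (Finset.card_insert_le _ _).trans (Nat.succ_le_succ ?_)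
    refine (Finset.card_biUnion_le_card_mul _ _ _ fun J _ => hScard J).trans ?_
    rw [Finset.card_univ, Fintype.card_set, Fintype.card_fin, ← mul_pow]
    norm_num
  have hTunit : ∀ u ∈ T, ‖u‖ = 1 := by
    intro u hu
    rcases Finset.mem_insert.1 hu with rfl | hu
    · exact ht _
    · obtain ⟨J, -, hJ⟩ := Finset.mem_biUnion.1 hu
      exact (hSA J hJ).1
  have hTbdd : ∀ u ∈ T, BddAbove ((fun z => ⟪z, u⟫) '' polySet t b) := by
    intro u hu
    rcases Finset.mem_insert.1 hu with rfl | hu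
    · exact ⟨b ⟨0, hm⟩, Set.forall_mem_image.2 fun z hz => hz _⟩
    · obtain ⟨J, -, hJ⟩ := Finset.mem_biUnion.1 hu
      obtain ⟨-, y, -, -, hmax⟩ := hSA J hJ
      exact ⟨⟪y, u⟫, Set.forall_mem_image.2 hmax⟩
  obtain ⟨s, hs⟩ := Finset.exists_fin_range_eq (Finset.insert_nonempty _ _) hTcard
  have hsT : ∀ j, s j ∈ T := fun j => Finset.mem_coe.1 (hs ▸ Set.mem_range_self j)
  refine ⟨s, fun j => sSup ((fun z => ⟪z, s j⟫) '' polySet t b), fun j => hTunit _ (hsT j),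
    fun z hz j => le_csSup (hTbdd _ (hsT j)) ⟨z, hz, rfl⟩, ?_⟩
  intro x hx
  by_contra hxt
  obtain ⟨y, hy, hinf⟩ := exists_norm_eq_iInf_of_complete_convex hne
    (isClosed_polySet t b).isComplete (convex_polySet t b) x
  have hproj := (norm_eq_iInf_iff_real_inner_le_zero (convex_polySet t b) hy).1 hinf
  have hdist : lam ≤ ‖x - y‖ := by
    by_contra! h
    exact hxt (Metric.mem_thickening_iff.2 ⟨y, hy, by rwa [dist_eq_norm]⟩)
  have hpos : 0 < ‖x - y‖ := hlam.trans_le hdist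
  set u : Euc d := ‖x - y‖⁻¹ • (x - y) with hudef
  have hxu : x - y = ‖x - y‖ • u := by
    rw [hudef, smul_smul, mul_inv_cancel₀ hpos.ne', one_smul]
  have hunorm : ‖u‖ = 1 := by
    rw [hudef, norm_smul, norm_inv, norm_norm, inv_mul_cancel₀ hpos.ne']
  have huA : u ∈ A {j | ⟪y, t j⟫ = b j} := by
    refine ⟨hunorm, y, hy, rfl, fun z hz => ?_⟩
    have h1 : ⟪z - y, u⟫ ≤ 0 := by
      rw [hudef, real_inner_smul_right, real_inner_comm]
      exact mul_nonpos_of_nonneg_of_nonpos (inv_nonneg.2 hpos.le) (hproj z hz)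
    rw [inner_sub_left] at h1
    linarith
  obtain ⟨v, hvS, huv⟩ := hSnet _ u huA
  obtain ⟨hvnorm, y', hy', hact, hmax'⟩ := hSA _ hvS
  have hmax : ∀ z ∈ polySet t b, ⟪z, v⟫ ≤ ⟪y, v⟫ :=
    inner_le_of_active_iff hy' hmax' fun j hj => (Set.ext_iff.1 hact j).1 hj
  have hsup : sSup ((fun z => ⟪z, v⟫) '' polySet t b) = ⟪y, v⟫ :=
    IsGreatest.csSup_eq ⟨⟨y, hy, rfl⟩, Set.forall_mem_image.2 hmax⟩
  have hvT : v ∈ Set.range s := by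
    rw [hs]
    exact Finset.mem_insert_of_mem (Finset.mem_biUnion.2 ⟨_, Finset.mem_univ _, hvS⟩)
  obtain ⟨j, rfl⟩ := hvT
  have hxj := hx j
  simp only [hsup] at hxj
  have hinner : 1 / 2 < ⟪u, s j⟫ := by
    have h := norm_sub_sq_real u (s j)
    rw [hunorm, hvnorm] at h
    have : ‖u - s j‖ ^ 2 < 1 := by
      rw [sq_lt_one_iff₀ (norm_nonneg _)]
      exact huv
    linarith
  have hsplit : ⟪x, s j⟫ = ⟪y, s j⟫ + ‖x - y‖ * ⟪u, s j⟫ := by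
    rw [← real_inner_smul_left, ← hxu, inner_sub_left]
    ring
  nlinarith

lemma pr_mono {d : ℕ} (P : Measure (Euc d)) [IsFiniteMeasure P] {s t : Set (Euc d)} (h : s ⊆ t) :
    pr P s ≤ pr P t := ENNReal.toReal_mono (measure_ne_top P t) (measure_mono h)

lemma pr_nonneg {d : ℕ} (P : Measure (Euc d)) (s : Set (Euc d)) : 0 ≤ pr P s :=
  ENNReal.toReal_nonneg

lemma pr_le_one {d : ℕ} (P : Measure (Euc d)) [IsProbabilityMeasure P] (s : Set (Euc d)) :
    pr P s ≤ 1 := ENNReal.toReal_mono ENNReal.one_ne_top prob_le_one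

lemma le_LlamPoly {d N : ℕ} (P Q : Measure (Euc d)) [IsProbabilityMeasure P]
    [IsProbabilityMeasure Q] (lam : ℝ) {t : Fin N → Euc d} (b : Fin N → ℝ)
    (ht : ∀ j, ‖t j‖ = 1) :
    max (pr P (polySet t b) - pr Q (polySet t (fun j => b j + lam)))
      (pr Q (polySet t b) - pr P (polySet t (fun j => b j + lam))) ≤ LlamPoly N P Q lam := by
  refine le_csSup ⟨1, ?_⟩ ⟨t, b, ht, rfl⟩
  rintro r ⟨t, b, -, rfl⟩
  exact max_le (by linarith [pr_le_one P (polySet t b), pr_nonneg Q (polySet t fun j => b j + lam)])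
    (by linarith [pr_le_one Q (polySet t b), pr_nonneg P (polySet t fun j => b j + lam)])

/-- `L_{λ,m}` is nonnegative: half-spaces moved to infinity have vanishing probability. -/
lemma LlamPoly_nonneg {d N : ℕ} (hN : 0 < N) (P Q : Measure (Euc d)) [IsProbabilityMeasure P]
    [IsProbabilityMeasure Q] (lam : ℝ) : 0 ≤ LlamPoly N P Q lam := by
  rcases Nat.eq_zero_or_pos d with rfl | hd
  · refine Real.sSup_nonneg ?_
    rintro r ⟨t, b, ht, rfl⟩
    have h := ht ⟨0, hN⟩
    rw [Subsingleton.elim (t ⟨0, hN⟩) 0, norm_zero] at h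
    exact absurd h zero_ne_one
  · let e : Euc d := EuclideanSpace.single ⟨0, hd⟩ 1
    have he : ‖e‖ = 1 := by simp [e]
    let f : Euc d → ℝ := fun x => ⟪x, e⟫
    have hf : Measurable f := by fun_prop
    have : IsProbabilityMeasure (Measure.map f Q) := Measure.isProbabilityMeasure_map hf.aemeasurable
    have hset : ∀ a : ℝ, polySet (fun _ : Fin N => e) (fun _ => a) = f ⁻¹' Set.Iic a := fun a =>
      Set.ext fun x => ⟨fun h => h ⟨0, hN⟩, fun h _ => h⟩
    have hbound : ∀ a : ℝ, -ProbabilityTheory.cdf (Measure.map f Q) (a + lam) ≤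
        LlamPoly N P Q lam := by
      intro a
      have h := (le_max_left _ _).trans
        (le_LlamPoly P Q lam (t := fun _ : Fin N => e) (fun _ => a) fun _ => he)
      rw [hset (a + lam)] at h
      rw [ProbabilityTheory.cdf_eq_real, Measure.real, Measure.map_apply hf measurableSet_Iic]
      have := pr_nonneg P (polySet (fun _ : Fin N => e) fun _ => a)
      simp only [pr] at *
      linarith
    have hlim : Filter.Tendsto (fun a : ℝ => -ProbabilityTheory.cdf (Measure.map f Q) (a + lam))
        Filter.atBot (nhds 0) := by
      simpa using ((ProbabilityTheory.tendsto_cdf_atBot (Measure.map f Q)).comp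
        (Filter.tendsto_atBot_add_const_right _ lam Filter.tendsto_id)).neg
    exact le_of_tendsto' hlim hbound

/-- **Key step in the proof of Theorem 8.** For every `m` there is `N_m ∈ ℕ`, depending only
on `m`, such that in every dimension `d`, `π_{λ,m}(ξ, ξ') ≤ L_{λ/2, N_m}(ξ, ξ')` for all
random vectors `ξ, ξ'` and all `λ > 0`. -/
theorem pilam_le_Llam_half (m : ℕ) :
    ∃ N : ℕ, ∀ (d : ℕ) (Ω : Type) (_ : MeasurableSpace Ω) (μ : Measure Ω),
      IsProbabilityMeasure μ →
      ∀ ξ ξ' : Ω → Euc d, Measurable ξ → Measurable ξ' →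
        ∀ lam : ℝ, 0 < lam →
          pilamPoly m (Measure.map ξ μ) (Measure.map ξ' μ) lam ≤
            LlamPoly N (Measure.map ξ μ) (Measure.map ξ' μ) (lam / 2) := by
  refine ⟨10 ^ m + 1, fun d Ω _ μ hμ ξ ξ' hξ hξ' lam hlam => ?_⟩
  have hP : IsProbabilityMeasure (Measure.map ξ μ) :=
    Measure.isProbabilityMeasure_map hξ.aemeasurable
  have hQ : IsProbabilityMeasure (Measure.map ξ' μ) :=
    Measure.isProbabilityMeasure_map hξ'.aemeasurable
  have hL := LlamPoly_nonneg (Nat.succ_pos (10 ^ m)) (Measure.map ξ μ) (Measure.map ξ' μ) (lam / 2)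
  refine Real.sSup_le ?_ hL
  rintro r ⟨t, b, ht, rfl⟩
  rcases (polySet t b).eq_empty_or_nonempty with hempty | hne
  · simpa [hempty, pr] using hL
  rcases Nat.eq_zero_or_pos m with rfl | hm
  · have huniv : polySet t b = Set.univ := Set.eq_univ_of_forall fun x j => j.elim0
    have hthick : Metric.thickening lam (polySet t b) = Set.univ :=
      Set.univ_subset_iff.1 (huniv ▸ Metric.self_subset_thickening hlam _)
    rw [hthick, huniv]
    simpa [pr] using hL
  · obtain ⟨s, c, hs, hsub, hthick⟩ := exists_polySet_relax_subset_thickening ht hm hne hlam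
    refine le_trans ?_ (le_LlamPoly (Measure.map ξ μ) (Measure.map ξ' μ) (lam / 2) c hs)
    exact max_le_max (sub_le_sub (pr_mono _ hsub) (pr_mono _ hthick))
      (sub_le_sub (pr_mono _ hsub) (pr_mono _ hthick))

end
end

section
/- For all constants c > 0 and ε > 0 there exists a constant c' > 0 depending only on c and ε with the following property: for every d, m ∈ ℕ, all random vectors ξ, ξ' in ℝ^d, every τ > 0, and every p ≥ 0, if L_{λ,m}(ξ, ξ') ≤ c · (p + exp(−ε · λ/τ)) for all λ > 0, then L_m(ξ, ξ') ≤ c' · (p + τ(|log τ| + 1)). -/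
open MeasureTheory
open scoped RealInnerProductSpace

noncomputable section

/-- `L_m`: the Lévy-type distance over polyhedra from `𝒫_m` (with representations). -/
def LmPoly {d : ℕ} (m : ℕ) (P Q : Measure (Euc d)) : ℝ :=
  sInf {lam | 0 ≤ lam ∧ ∀ (t : Fin m → Euc d) (b : Fin m → ℝ), (∀ j, ‖t j‖ = 1) →
    pr P (polySet t b) ≤ pr Q (polySet t (fun j => b j + lam)) + lam ∧
    pr Q (polySet t b) ≤ pr P (polySet t (fun j => b j + lam)) + lam}

/-- Every admissible pair of directions and levels gives a lower bound for `LlamPoly`. -/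
theorem max_pr_sub_le_LlamPoly {d m : ℕ} (P Q : Measure (Euc d)) [IsProbabilityMeasure P]
    [IsProbabilityMeasure Q] (lam : ℝ) (t : Fin m → Euc d) (b : Fin m → ℝ)
    (ht : ∀ j, ‖t j‖ = 1) :
    max (pr P (polySet t b) - pr Q (polySet t (fun j => b j + lam)))
      (pr Q (polySet t b) - pr P (polySet t (fun j => b j + lam))) ≤ LlamPoly m P Q lam := by
  refine le_csSup ⟨1, ?_⟩ ⟨t, b, ht, rfl⟩
  rintro r ⟨t, b, -, rfl⟩
  have le_one (R : Measure (Euc d)) [IsProbabilityMeasure R] (s : Set (Euc d)) : pr R s ≤ 1 :=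
    measureReal_le_one
  have nonneg (R : Measure (Euc d)) (s : Set (Euc d)) : 0 ≤ pr R s := ENNReal.toReal_nonneg
  exact max_le
    (by linarith [le_one P (polySet t b), nonneg Q (polySet t (fun j => b j + lam))])
    (by linarith [le_one Q (polySet t b), nonneg P (polySet t (fun j => b j + lam))])

/-- A bound `LlamPoly m P Q lam ≤ lam` yields `LmPoly m P Q ≤ lam`. -/
theorem LmPoly_le_of_LlamPoly_le {d m : ℕ} (P Q : Measure (Euc d)) [IsProbabilityMeasure P]
    [IsProbabilityMeasure Q] {lam : ℝ} (hlam : 0 ≤ lam) (h : LlamPoly m P Q lam ≤ lam) :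
    LmPoly m P Q ≤ lam := by
  refine csInf_le ⟨0, fun r hr => hr.1⟩ ⟨hlam, fun t b ht => ?_⟩
  obtain ⟨h₁, h₂⟩ := max_le_iff.1 ((max_pr_sub_le_LlamPoly P Q lam t b ht).trans h)
  exact ⟨by linarith, by linarith⟩

/-- **Standard reasoning (Remarks 1, 3).** An exponential bound
`L_{λ,m} ≤ c (p + exp (-ε λ / τ))` valid for all `λ > 0` implies
`L_m ≤ c' (p + τ (|log τ| + 1))` with `c'` depending only on `c` and `ε`. -/
theorem Llam_exp_bound_to_Lm_bound (c ε : ℝ) (hc : 0 < c) (hε : 0 < ε) :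
    ∃ c' : ℝ, 0 < c' ∧
      ∀ (d m : ℕ) (Ω : Type) (_ : MeasurableSpace Ω) (μ : Measure Ω),
        IsProbabilityMeasure μ →
        ∀ ξ ξ' : Ω → Euc d, Measurable ξ → Measurable ξ' →
          ∀ τ p : ℝ, 0 < τ → 0 ≤ p →
            (∀ lam : ℝ, 0 < lam →
              LlamPoly m (Measure.map ξ μ) (Measure.map ξ' μ) lam ≤
                c * (p + Real.exp (-ε * lam / τ))) →
            LmPoly m (Measure.map ξ μ) (Measure.map ξ' μ) ≤
              c' * (p + τ * (|Real.log τ| + 1)) := by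
  refine ⟨c + 1 / ε, by positivity, ?_⟩
  intro d m Ω _ μ _ ξ ξ' hξ hξ' τ p hτ hp h
  have := Measure.isProbabilityMeasure_map (μ := μ) hξ.aemeasurable
  have := Measure.isProbabilityMeasure_map (μ := μ) hξ'.aemeasurable
  set K := |Real.log τ| + 1 with hK
  have hK1 : 1 ≤ K := by linarith [abs_nonneg (Real.log τ)]
  have hεinv : 0 < 1 / ε := by positivity
  have hlam : 0 < (c + 1 / ε) * (p + τ * K) := by positivity
  refine LmPoly_le_of_LlamPoly_le _ _ hlam.le ((h _ hlam).trans ?_)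
  have hexp : Real.exp (-ε * ((c + 1 / ε) * (p + τ * K)) / τ) ≤ τ := by
    rw [← Real.le_log_iff_exp_le hτ, div_le_iff₀ hτ]
    have hle : τ * K ≤ ε * ((c + 1 / ε) * (p + τ * K)) := by
      have : ε * ((c + 1 / ε) * (p + τ * K)) = τ * K + (ε * c * (p + τ * K) + p) := by
        field_simp
        ring
      rw [this]
      have : 0 ≤ ε * c * (p + τ * K) + p := by positivity
      linarith
    have hlog : -K ≤ Real.log τ := by linarith [neg_abs_le (Real.log τ)]
    nlinarith [mul_le_mul_of_nonneg_right hlog hτ.le]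
  calc c * (p + Real.exp (-ε * ((c + 1 / ε) * (p + τ * K)) / τ))
      ≤ c * (p + τ * K) := by
        gcongr
        exact hexp.trans (le_mul_of_one_le_right hτ.le hK1)
    _ ≤ (c + 1 / ε) * (p + τ * K) := by
        gcongr
        linarith

end
end
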